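/- Let $Q \subseteq \mathbb{C}^n$ be a compact convex set, $f: Q \to \mathbb{C}$ a function holomorphic on a neighborhood of $Q$, and $\varepsilon > 0$. Then there is a polynomial $p$ on $\mathbb{C}^n$ with $\sup_{z \in Q} |f(z) - p(z)| < \varepsilon$. -/

import Mathlib

open Set Filter Topology

section

variable {X : Type*} [TopologicalSpace X] [CompactSpace X]

/-- A family of continuous functions on a compact space which is jointly continuous and
pointwise holomorphic in a complex parameter is analytic for the uniform norm. -/
theorem ContinuousMap.analyticOnNhd_of_differentiableOn_eval {W : Set ℂ} (hW : IsOpen W)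
    {F : ℂ → C(X, ℂ)} (hc : ContinuousOn (fun p : ℂ × X => F p.1 p.2) (W ×ˢ univ))
    (hd : ∀ x, DifferentiableOn ℂ (fun t => F t x) W) : AnalyticOnNhd ℂ F W := by
  have hFc : ContinuousOn F W := by
    rw [continuousOn_iff_continuous_domRestrict]
    refine ContinuousMap.continuous_of_continuous_uncurry _ ?_
    exact hc.comp_continuous (f := fun p : W × X => ((p.1 : ℂ), p.2)) (by fun_prop)
      fun p => ⟨p.1.2, mem_univ _⟩
  intro t ht
  obtain ⟨R, hR, hRW⟩ := Metric.nhds_basis_closedBall.mem_iff.1 (hW.mem_nhds ht)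
  lift R to NNReal using hR.le
  have hFint : CircleIntegrable F t R :=
    (hFc.mono (Metric.sphere_subset_closedBall.trans hRW)).circleIntegrable R.2
  refine (hasFPowerSeriesOn_cauchy_integral hFint (by exact_mod_cast hR)).analyticAt.congr ?_
  filter_upwards [Metric.ball_mem_nhds t hR] with w hw
  have hwc : ∀ z ∈ Metric.sphere t (R : ℝ), z - w ≠ 0 := by
    intro z hz h
    rw [sub_eq_zero] at h
    subst h
    exact (Metric.mem_ball.1 hw).ne hz
  have hkint : CircleIntegrable (fun z => (z - w)⁻¹ • F z) t R := by
    refine ContinuousOn.circleIntegrable R.2 (ContinuousOn.fun_smul ?_ ?_)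
    · exact ContinuousOn.inv₀ (by fun_prop) hwc
    · exact hFc.mono (Metric.sphere_subset_closedBall.trans hRW)
  ext x
  have hx : (∮ z in C(t, R), (z - w)⁻¹ • F z) x = ∮ z in C(t, R), (z - w)⁻¹ • F z x := by
    have := (ContinuousMap.evalCLM ℂ x : C(X, ℂ) →L[ℂ] ℂ).intervalIntegral_comp_comm hkint.out
    exact this.symm
  rw [ContinuousMap.smul_apply, hx]
  refine DiffContOnCl.two_pi_i_inv_smul_circleIntegral_sub_inv_smul ?_ hw
  refine DifferentiableOn.diffContOnCl ((hd x).mono ?_)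
  exact Metric.closure_ball_subset_closedBall.trans hRW

/-- The integral of a continuous family with values in a closed subspace of `C(X, ℂ)` is again
in the subspace. -/
theorem ContinuousMap.mem_of_eval_eq_intervalIntegral {S : Submodule ℂ C(X, ℂ)}
    (hS : IsClosed (S : Set C(X, ℂ))) {G : ℝ → C(X, ℂ)} (hG : Continuous G)
    (hmem : ∀ θ, G θ ∈ S) {a b : ℝ} {F : C(X, ℂ)} (hF : ∀ x, F x = ∫ θ in a..b, G θ x) :
    F ∈ S := by
  have : IsClosed (S : Set C(X, ℂ)) := hS
  have hFG : F = ∫ θ in a..b, G θ := by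
    ext x
    rw [hF]
    exact (ContinuousMap.evalCLM ℂ x : C(X, ℂ) →L[ℂ] ℂ).intervalIntegral_comp_comm
      (hG.intervalIntegrable a b)
  have h := S.mkQL.intervalIntegral_comp_comm (hG.intervalIntegrable (μ := MeasureTheory.volume) a b)
  rw [← hFG] at h
  have h0 : ∀ θ, S.mkQL (G θ) = 0 := fun θ => by simpa using hmem θ
  simpa [h0] using h.symm

/-- An element `1 - u` with `‖u‖ < 1` of a closed subalgebra has its inverse in the subalgebra. -/
theorem ContinuousMap.mem_of_mul_one_sub_eq_one {A : Subalgebra ℂ C(X, ℂ)}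
    (hA : IsClosed (A : Set C(X, ℂ))) {u v : C(X, ℂ)} (hu : u ∈ A) (hu1 : ‖u‖ < 1)
    (huv : v * (1 - u) = 1) : v ∈ A := by
  have h := mul_neg_geom_series u hu1
  have : v = ∑' i : ℕ, u ^ i := by
    calc v = v * ((1 - u) * ∑' i : ℕ, u ^ i) := by rw [h, mul_one]
      _ = _ := by rw [← mul_assoc, huv, one_mul]
  rw [this]
  exact tsum_mem hA fun i => pow_mem hu i

end

section

variable {ι : Type*}

/-- The `i`-th coordinate as a continuous function on `K`. -/
def coordinateMap (K : Set (ι → ℂ)) (i : ι) : C(K, ℂ) :=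
  ⟨fun z => z.1 i, (continuous_apply i).comp continuous_subtype_val⟩

@[simp]
theorem coordinateMap_apply (K : Set (ι → ℂ)) (i : ι) (z : K) : coordinateMap K i z = z.1 i :=
  rfl

/-- The uniform closure of the polynomial functions on `K`. -/
noncomputable def polynomialClosure (K : Set (ι → ℂ)) [CompactSpace K] :
    Subalgebra ℂ C(K, ℂ) :=
  (MvPolynomial.aeval (R := ℂ) (coordinateMap K)).range.topologicalClosure

variable {K : Set (ι → ℂ)} [CompactSpace K]

theorem isClosed_polynomialClosure : IsClosed (polynomialClosure K : Set C(K, ℂ)) :=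
  Subalgebra.isClosed_topologicalClosure _

theorem coord_mem_polynomialClosure (i : ι) :
    coordinateMap K i ∈ polynomialClosure K :=
  Subalgebra.le_topologicalClosure _ ⟨MvPolynomial.X i, by simp⟩

theorem exists_mvPolynomial_of_mem_polynomialClosure {F : C(K, ℂ)} (hF : F ∈ polynomialClosure K)
    {ε : ℝ} (hε : 0 < ε) :
    ∃ p : MvPolynomial ι ℂ, ∀ z : K, ‖F z - MvPolynomial.eval z.1 p‖ < ε := by
  obtain ⟨_, ⟨p, rfl⟩, hp⟩ := Metric.mem_closure_iff.1 hF ε hε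
  refine ⟨p, fun z => ?_⟩
  have h := (ContinuousMap.dist_lt_iff hε).1 hp z
  have hev : MvPolynomial.aeval (coordinateMap K) p z = MvPolynomial.eval z.1 p := by
    clear hp h
    induction p using MvPolynomial.induction_on <;> simp_all
  rw [dist_eq_norm] at h
  rwa [← hev]

/-- A Cauchy kernel in one coordinate is a uniform limit of polynomials on a set contained in the
disc. -/
theorem cauchyKernel_mem_polynomialClosure {i : ι} {c w : ℂ} {R : ℝ} (hw : ‖w - c‖ = R)
    (hK : ∀ z ∈ K, ‖z i - c‖ < R) {v : C(K, ℂ)} (hv : ∀ z : K, v z = (w - z.1 i)⁻¹)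
    (hR : 0 < R) : v ∈ polynomialClosure K := by
  have hwc : w - c ≠ 0 := norm_pos_iff.1 (hw ▸ hR)
  have hne : ∀ z : K, w - z.1 i ≠ 0 := by
    intro z h
    rw [sub_eq_zero] at h
    have := hK z z.2
    rw [← h, hw] at this
    exact lt_irrefl _ this
  let u : C(K, ℂ) := (w - c)⁻¹ • (coordinateMap K i - algebraMap ℂ _ c)
  have hu : u ∈ polynomialClosure K :=
    Subalgebra.smul_mem _ (sub_mem (coord_mem_polynomialClosure i) (Subalgebra.algebraMap_mem _ _)) _
  have hux : ∀ z : K, u z = (w - c)⁻¹ * (z.1 i - c) := fun z => rfl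
  have hu1 : ‖u‖ < 1 := by
    rw [ContinuousMap.norm_lt_iff _ one_pos]
    intro z
    rw [hux, norm_mul, norm_inv, hw, inv_mul_lt_one₀ hR]
    exact hK z z.2
  have hmem : (w - c) • v ∈ polynomialClosure K := by
    refine ContinuousMap.mem_of_mul_one_sub_eq_one isClosed_polynomialClosure hu hu1 ?_
    ext z
    have := hne z
    simp only [ContinuousMap.mul_apply, ContinuousMap.smul_apply, ContinuousMap.sub_apply,
      ContinuousMap.one_apply, hux, hv, smul_eq_mul]
    field_simp
    ring
  have := Subalgebra.smul_mem _ hmem (w - c)⁻¹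
  rwa [inv_smul_smul₀ hwc] at this

/-- A function holomorphic near a closed polydisc is a uniform limit of polynomials on each
compact subset of the open polydisc. -/
theorem mem_polynomialClosure_of_differentiableAt_closedBall [Fintype ι] {c : ι → ℂ} {R : ℝ}
    (hR : 0 < R) (hK : K ⊆ Metric.ball c R) {g : (ι → ℂ) → ℂ}
    (hg : ∀ z ∈ Metric.closedBall c R, DifferentiableAt ℂ g z) {F : C(K, ℂ)}
    (hF : ∀ z : K, F z = g z) : F ∈ polynomialClosure K := by
  classical
  have hgc : ContinuousOn g (Metric.closedBall c R) :=
    fun z hz => (hg z hz).continuousAt.continuousWithinAt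
  have hKi : ∀ z ∈ K, ∀ i, ‖z i - c i‖ < R := fun z hz i => by
    simpa [dist_eq_norm] using (dist_pi_lt_iff hR).1 (hK hz) i
  have hball : ∀ z : ι → ℂ, z ∈ Metric.closedBall c R ↔ ∀ i, ‖z i - c i‖ ≤ R := fun z => by
    simp only [mem_closedBall_iff_norm, pi_norm_le_iff_of_nonneg hR.le, Pi.sub_apply]
  suffices H : ∀ (s : Finset ι) (ζ : ι → ℂ), ζ ∈ Metric.closedBall c R → ∀ F : C(K, ℂ),
      (∀ z : K, F z = g (s.piecewise z.1 ζ)) → F ∈ polynomialClosure K from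
    H Finset.univ c (Metric.mem_closedBall_self hR.le) F (by simpa using hF)
  intro s
  induction s using Finset.induction_on with
  | empty =>
    intro ζ _ F hF
    convert Subalgebra.algebraMap_mem (polynomialClosure K) (g ζ)
    ext z
    simp [hF]
  | insert j s hj ih =>
    intro ζ hζ F hF
    have hmemU : ∀ z ∈ K, ∀ w : ℂ, ‖w - c j‖ ≤ R →
        s.piecewise z (Function.update ζ j w) ∈ Metric.closedBall c R := by
      intro z hz w hw
      rw [hball] at hζ ⊢
      intro i
      by_cases his : i ∈ s
      · simpa [his] using (hKi z hz i).le
      · by_cases hij : i = j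
        · subst hij; simpa [his] using hw
        · simpa [his, hij] using hζ i
    have hcirc : ∀ θ, ‖circleMap (c j) R θ - c j‖ = R := fun θ => by
      simp [circleMap, abs_of_pos hR]
    have hpc : Continuous fun p : ℂ × K => s.piecewise p.2.1 (Function.update ζ j p.1) := by
      refine continuous_pi fun i => ?_
      by_cases his : i ∈ s
      · simp only [his, Finset.piecewise_eq_of_mem]
        exact (coordinateMap K i).continuous.comp continuous_snd
      · by_cases hij : i = j
        · subst hij; simpa [his] using continuous_fst
        · simpa [his, hij] using continuous_const
    have hgp : Continuous fun p : ℝ × K =>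
        g (s.piecewise p.2.1 (Function.update ζ j (circleMap (c j) R p.1))) :=
      hgc.comp_continuous
        (hpc.comp (((continuous_circleMap _ _).comp continuous_fst).prodMk continuous_snd))
        fun p => hmemU _ p.2.2 _ (hcirc _).le
    have hkp : Continuous fun p : ℝ × K => (circleMap (c j) R p.1 - p.2.1 j)⁻¹ := by
      refine Continuous.inv₀ ?_ fun p h => ?_
      · exact ((continuous_circleMap _ _).comp continuous_fst).sub
          ((coordinateMap K j).continuous.comp continuous_snd)
      · rw [sub_eq_zero] at h
        have := hKi _ p.2.2 j
        rw [← h, hcirc] at this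
        exact lt_irrefl _ this
    let G₁ : C(ℝ, C(K, ℂ)) := ContinuousMap.curry ⟨_, hkp⟩
    let G₂ : C(ℝ, C(K, ℂ)) := ContinuousMap.curry ⟨_, hgp⟩
    have hd : Continuous fun θ : ℝ =>
        (2 * Real.pi * Complex.I : ℂ)⁻¹ * deriv (circleMap (c j) R) θ := by
      simp only [deriv_circleMap]
      fun_prop
    refine ContinuousMap.mem_of_eval_eq_intervalIntegral
      (S := Subalgebra.toSubmodule (polynomialClosure K)) isClosed_polynomialClosure
      (G := fun θ => ((2 * Real.pi * Complex.I : ℂ)⁻¹ * deriv (circleMap (c j) R) θ) •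
        (G₁ θ * G₂ θ)) (a := 0) (b := 2 * Real.pi)
      (hd.smul (G₁.continuous.mul G₂.continuous)) (fun θ => ?_) fun z => ?_
    · refine Subalgebra.smul_mem _ (mul_mem ?_ ?_) _
      · exact cauchyKernel_mem_polynomialClosure (hcirc θ) (fun z hz => hKi z hz j)
          (fun z => rfl) hR
      · refine ih (Function.update ζ j (circleMap (c j) R θ)) ?_ _ fun z => rfl
        rw [hball] at hζ ⊢
        intro i
        by_cases hij : i = j
        · subst hij; simpa using (hcirc θ).le
        · simpa [hij] using hζ i
    · have hsec : ∀ w : ℂ, s.piecewise z.1 (Function.update ζ j w) =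
          Function.update (s.piecewise z.1 ζ) j w := by
        intro w
        ext i
        by_cases hij : i = j
        · subst hij; simp [hj]
        · by_cases his : i ∈ s <;> simp [his, hij]
      have hdiff : ∀ w ∈ Metric.closedBall (c j) R, DifferentiableAt ℂ
          (fun w => g (s.piecewise z.1 (Function.update ζ j w))) w := by
        intro w hw
        have h1 := hg _ (hmemU z z.2 w (by simpa [dist_eq_norm] using hw))
        simp only [hsec] at h1 ⊢
        exact h1.comp w (hasFDerivAt_update (𝕜 := ℂ) (E := fun _ => ℂ) _ w).differentiableAt
      have hcauchy := DiffContOnCl.two_pi_i_inv_smul_circleIntegral_sub_inv_smul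
        (f := fun w => g (s.piecewise z.1 (Function.update ζ j w))) (c := c j) (R := R)
        (w := z.1 j)
        (DifferentiableOn.diffContOnCl fun w hw =>
          (hdiff w (Metric.closure_ball_subset_closedBall hw)).differentiableWithinAt)
        (by simpa [dist_eq_norm] using hKi z z.2 j)
      rw [hF, Finset.piecewise_insert, ← hsec, ← hcauchy, circleIntegral, smul_eq_mul,
        ← intervalIntegral.integral_const_mul]
      refine intervalIntegral.integral_congr fun θ _ => ?_
      simp [G₁, G₂, mul_assoc]

end

/-- Approximation on compact star-shaped sets: a function holomorphic near such a set is a uniform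
limit of polynomials on it. -/
theorem StarConvex.exists_mvPolynomial_norm_sub_lt {ι : Type*} [Fintype ι] {K U : Set (ι → ℂ)}
    {c : ι → ℂ} (hKc : IsCompact K) (hstar : StarConvex ℝ c K) (hcK : c ∈ K) (hU : IsOpen U)
    (hKU : K ⊆ U) {f : (ι → ℂ) → ℂ} (hf : DifferentiableOn ℂ f U) {ε : ℝ} (hε : 0 < ε) :
    ∃ p : MvPolynomial ι ℂ, ∀ z ∈ K, ‖f z - MvPolynomial.eval z p‖ < ε := by
  classical
  have : CompactSpace K := isCompact_iff_compactSpace.1 hKc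
  let δ : ℂ → (ι → ℂ) → (ι → ℂ) := fun t z => c + t • (z - c)
  have hδ : Continuous fun p : ℂ × (ι → ℂ) => δ p.1 p.2 := by fun_prop
  let W : Set ℂ := {t | ∀ z ∈ K, δ t z ∈ U}
  have hW : IsOpen W := by
    rw [isOpen_iff_mem_nhds]
    intro t ht
    exact hKc.eventually_forall_of_forall_eventually fun z hz =>
      hδ.continuousAt.preimage_mem_nhds (hU.mem_nhds (ht z hz))
  have hcont : ∀ t ∈ W, Continuous fun z : K => f (δ t z) := fun t ht =>
    hf.continuousOn.comp_continuous (by fun_prop) fun z => ht z z.2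
  let F : ℂ → C(K, ℂ) := fun t => if ht : t ∈ W then ⟨_, hcont t ht⟩ else 0
  have hF : ∀ t ∈ W, ∀ z : K, F t z = f (δ t z) := fun t ht z => by simp [F, ht]
  have hFan : AnalyticOnNhd ℂ F W := by
    refine ContinuousMap.analyticOnNhd_of_differentiableOn_eval hW ?_ fun z => ?_
    · refine ContinuousOn.congr (f := fun p : ℂ × K => f (δ p.1 p.2)) ?_ fun p hp => hF _ hp.1 _
      exact hf.continuousOn.comp (by fun_prop) fun p hp => hp.1 _ p.2.2
    · refine DifferentiableOn.congr (f := fun t => f (δ t z)) ?_ fun t ht => hF t ht z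
      exact hf.comp (by fun_prop) fun t ht => ht z z.2
  have hsub : ((↑) : ℝ → ℂ) '' Icc 0 1 ⊆ W := by
    rintro _ ⟨t, ht, rfl⟩ z hz
    refine hKU ?_
    have h := hstar hz (sub_nonneg.2 ht.2) ht.1 (sub_add_cancel 1 t)
    convert h using 1
    ext i
    simp [δ]
    ring
  obtain ⟨R, hR, hKR⟩ := hKc.isBounded.subset_ball_lt 0 c
  obtain ⟨r, hr, hrU⟩ := Metric.nhds_basis_ball.mem_iff.1 (hU.mem_nhds (hKU hcK))
  have hsmall : ∀ t ∈ Metric.ball (0 : ℂ) (r / R), F t ∈ polynomialClosure K := by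
    intro t ht
    rw [mem_ball_zero_iff, lt_div_iff₀ hR] at ht
    have hmem : ∀ z ∈ Metric.closedBall c R, δ t z ∈ U := by
      intro z hz
      apply hrU
      rw [mem_closedBall_iff_norm] at hz
      rw [mem_ball_iff_norm]
      simp only [δ, add_sub_cancel_left, norm_smul]
      exact (mul_le_mul_of_nonneg_left hz (norm_nonneg t)).trans_lt ht
    refine mem_polynomialClosure_of_differentiableAt_closedBall hR hKR
      (g := fun z => f (δ t z)) (fun z hz => ?_)
      (hF t fun z hz => hmem z (Metric.ball_subset_closedBall (hKR hz)))
    exact (hf.differentiableAt (hU.mem_nhds (hmem z hz))).comp z (by fun_prop)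
  let S := Subalgebra.toSubmodule (polynomialClosure K)
  have : IsClosed (S : Set C(K, ℂ)) := isClosed_polynomialClosure
  have hquot : EqOn (S.mkQL ∘ F) 0 (((↑) : ℝ → ℂ) '' Icc 0 1) := by
    refine AnalyticOnNhd.eqOn_zero_of_preconnected_of_eventuallyEq_zero (𝕜 := ℂ) (z₀ := 0)
      (S.mkQL.comp_analyticOnNhd (hFan.mono hsub))
      (isPreconnected_Icc.image _ Complex.continuous_ofReal.continuousOn) ⟨0, by simp⟩ ?_
    filter_upwards [Metric.ball_mem_nhds (0 : ℂ) (div_pos hr hR)] with t ht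
    simpa [S] using hsmall t ht
  have h1 : (1 : ℂ) ∈ ((↑) : ℝ → ℂ) '' Icc 0 1 := ⟨1, by simp⟩
  have hF1 : F 1 ∈ polynomialClosure K := by simpa [S] using hquot h1
  obtain ⟨p, hp⟩ := exists_mvPolynomial_of_mem_polynomialClosure hF1 hε
  refine ⟨p, fun z hz => ?_⟩
  simpa [hF 1 (hsub h1), δ] using hp ⟨z, hz⟩

/-- Oka–Weil approximation on compact convex sets: a function holomorphic on a neighborhood
of a compact convex set `Q ⊆ ℂⁿ` can be approximated uniformly on `Q` by polynomials. -/
theorem oka_weil_convex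
    (n : ℕ) (Q : Set (Fin n → ℂ)) (hQcp : IsCompact Q) (hQcv : Convex ℝ Q)
    (f : (Fin n → ℂ) → ℂ)
    (hf : ∃ U, IsOpen U ∧ Q ⊆ U ∧ DifferentiableOn ℂ f U)
    (ε : ℝ) (hε : 0 < ε) :
    ∃ p : MvPolynomial (Fin n) ℂ, ∀ z ∈ Q, ‖f z - MvPolynomial.eval z p‖ < ε := by
  obtain ⟨U, hU, hQU, hfU⟩ := hf
  obtain rfl | ⟨c, hc⟩ := Q.eq_empty_or_nonempty
  · exact ⟨0, by simp⟩
  · exact (hQcv hc).exists_mvPolynomial_norm_sub_lt hQcp hc hU hQU hfU hε
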